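/- Corollary C.4 (a generalized Assouad lower bound for restricted subfamilies). Let k ≥ 1 be an integer and V = {−1,1}^k. Let (Θ, ρ) be a metric space with its Borel σ-algebra, let Φ : [0,∞) → [0,∞) be nondecreasing, let ϱ > 0, and let θ_v ∈ Θ (v ∈ V) satisfy Φ(ρ(θ_u, θ_v)/2) = 2·ϱ·|{j : u_j ≠ v_j}| for all u, v ∈ V. Let Ω be a measurable space and (μ_v)_{v∈V} probability measures on Ω. Let τ ∈ (0, 1/2], give V the product weights w_v = τ^{|{j : v_j = 1}|}·(1−τ)^{|{j : v_j = −1}|}, and let V* ⊆ V and c > 0 satisfy Σ_{v∉V*} w_v ≤ c·τ. For j ∈ {1,…,k} define the mixture probability measures μ_{+j} = Σ_{v : v_j = 1} (w_v/τ)·μ_v and μ_{−j} = Σ_{v : v_j = −1} (w_v/(1−τ))·μ_v. Then for every measurable estimator θ̂ : Ω → Θ, sup_{v∈V*} ∫ Φ(ρ(θ̂(ω), θ_v)) dμ_v(ω) ≥ 2·ϱ·τ·( Σ_{j=1}^{k} (1 − D_TV(μ_{+j}, μ_{−j})) − c·k ). -/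

import Mathlib

open MeasureTheory Real
open scoped ENNReal

/-- The total variation distance between two measures,
`D_TV(μ, ν) = sup { μ(S) − ν(S) : S measurable }`. -/
noncomputable def tvDist {Ω : Type*} [MeasurableSpace Ω]
    (μ ν : MeasureTheory.Measure Ω) : ℝ :=
  ⨆ S : {S : Set Ω // MeasurableSet S}, ((μ (S : Set Ω)).toReal - (ν (S : Set Ω)).toReal)

/-- For finite measures, the total variation distance bounds the difference of the measures of any
measurable set. -/
theorem sub_le_tvDist {Ω : Type*} [MeasurableSpace Ω] (μ ν : Measure Ω) [IsFiniteMeasure μ]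
    {S : Set Ω} (hS : MeasurableSet S) : μ.real S - ν.real S ≤ tvDist μ ν := by
  refine le_ciSup (f := fun S : {S : Set Ω // MeasurableSet S} =>
    (μ (S : Set Ω)).toReal - (ν (S : Set Ω)).toReal) ⟨μ.real Set.univ, ?_⟩ ⟨S, hS⟩
  rintro _ ⟨T, rfl⟩
  have h₁ : μ.real T ≤ μ.real Set.univ := measureReal_mono (Set.subset_univ _)
  have h₂ : 0 ≤ ν.real T := measureReal_nonneg
  simp only [Measure.real] at h₁ h₂ ⊢
  linarith

/-- The value of a finite mixture of probability measures on a set. -/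
theorem measureReal_sum_ofReal_smul {ι Ω : Type*} [MeasurableSpace Ω] (s : Finset ι) (a : ι → ℝ)
    (ha : ∀ i ∈ s, 0 ≤ a i) (μ : ι → Measure Ω) [∀ i, IsProbabilityMeasure (μ i)] (S : Set Ω) :
    (∑ i ∈ s, ENNReal.ofReal (a i) • μ i).real S = ∑ i ∈ s, a i * (μ i).real S := by
  simp only [Measure.real, Measure.coe_finsetSum, Finset.sum_apply, Measure.smul_apply,
    smul_eq_mul]
  rw [ENNReal.toReal_sum fun i _ => ENNReal.mul_ne_top ENNReal.ofReal_ne_top (measure_ne_top _ _)]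
  refine Finset.sum_congr rfl fun i hi => ?_
  rw [ENNReal.toReal_mul, ENNReal.toReal_ofReal (ha i hi)]

/-- Weights counting the coordinates of a hypercube vertex are product weights. -/
theorem pow_card_mul_pow_card_eq_prod {k : ℕ} (a b : ℝ) (v : Fin k → Bool) :
    a ^ (Finset.univ.filter fun j => v j = true).card *
      b ^ (Finset.univ.filter fun j => v j = false).card = ∏ i, (if v i then a else b) := by
  rw [Finset.prod_ite, Finset.prod_const, Finset.prod_const]
  simp

/-- The marginal of a product weight on the hypercube. -/
theorem sum_filter_prod_eq {k : ℕ} (p : Bool → ℝ) (hp : p true + p false = 1) (j : Fin k)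
    (b : Bool) :
    ∑ v ∈ Finset.univ.filter (fun v : Fin k → Bool => v j = b), ∏ i, p (v i) = p b := by
  have h : Finset.univ.filter (fun v : Fin k → Bool => v j = b)
      = Fintype.piFinset (fun i => if i = j then {b} else Finset.univ) := by
    ext v
    simp only [Finset.mem_filter, Finset.mem_univ, true_and, Fintype.mem_piFinset]
    refine ⟨fun hv i => ?_, fun hv => by simpa using hv j⟩
    by_cases hi : i = j
    · subst hi; simpa using hv
    · simp [hi]
  rw [h, ← Finset.prod_univ_sum (fun i => if i = j then {b} else Finset.univ) fun _ x => p x,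
    Finset.prod_eq_single j]
  · simp
  · intro i _ hi
    simp [hi, hp]
  · simp

/-- The total mass of a product weight on the hypercube. -/
theorem sum_prod_eq_one {k : ℕ} (p : Bool → ℝ) (hp : p true + p false = 1) :
    ∑ v : Fin k → Bool, ∏ i, p (v i) = 1 := by
  rw [← Fintype.piFinset_univ, ← Finset.prod_univ_sum (fun _ => Finset.univ) fun _ x => p x]
  simp [hp]

/-- A measurable nearest-point projection onto a finite family of points. -/
theorem exists_simpleFunc_edist_le {Θ ι : Type*} [PseudoEMetricSpace Θ] [MeasurableSpace Θ]
    [OpensMeasurableSpace Θ] [Fintype ι] [Nonempty ι] (θ : ι → Θ) :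
    ∃ proj : SimpleFunc Θ ι, ∀ x i, edist (θ (proj x)) x ≤ edist (θ i) x := by
  obtain ⟨f, hf⟩ := exists_surjective_nat ι
  choose g hg using hf
  refine ⟨(SimpleFunc.nearestPtInd (θ ∘ f) (Finset.univ.sup g)).map f, fun x i => ?_⟩
  have h := SimpleFunc.edist_nearestPt_le (θ ∘ f) x
    (Finset.le_sup (f := g) (Finset.mem_univ i))
  simpa [SimpleFunc.nearestPt, hg] using h

/-- The two-point bound: a test between the two mixtures along one coordinate has weighted error
at least `τ (1 - D_TV)`. -/
theorem mul_one_sub_tvDist_le {k : ℕ} {Ω : Type*} [MeasurableSpace Ω]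
    (μ : (Fin k → Bool) → Measure Ω) [∀ v, IsProbabilityMeasure (μ v)]
    {τ : ℝ} (hτ0 : 0 < τ) (hτ1 : τ ≤ 1 / 2) (w : (Fin k → Bool) → ℝ) (hw : ∀ v, 0 ≤ w v)
    (j : Fin k) (hsum : ∑ v ∈ Finset.univ.filter (fun v => v j = true), w v = τ)
    (T : Ω → Bool) (hT : Measurable T) :
    τ * (1 - tvDist
        (∑ v ∈ Finset.univ.filter (fun v => v j = true), ENNReal.ofReal (w v / τ) • μ v)
        (∑ v ∈ Finset.univ.filter (fun v => v j = false), ENNReal.ofReal (w v / (1 - τ)) • μ v))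
      ≤ ∑ v, w v * (μ v).real {ω | T ω ≠ v j} := by
  have hτ' : 0 < 1 - τ := by linarith
  set S : Set Ω := {ω | T ω = true} with hSdef
  have hS : MeasurableSet S := hT (measurableSet_singleton true)
  have hfin : IsFiniteMeasure (∑ v ∈ Finset.univ.filter (fun v : Fin k → Bool => v j = true),
      ENNReal.ofReal (w v / τ) • μ v) := by
    refine ⟨?_⟩
    simp only [Measure.coe_finsetSum, Finset.sum_apply, Measure.smul_apply, smul_eq_mul]
    exact ENNReal.sum_lt_top.2 fun v _ =>
      ENNReal.mul_lt_top ENNReal.ofReal_lt_top (measure_lt_top _ _)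
  have hTV := sub_le_tvDist
    (∑ v ∈ Finset.univ.filter (fun v => v j = true), ENNReal.ofReal (w v / τ) • μ v)
    (∑ v ∈ Finset.univ.filter (fun v => v j = false), ENNReal.ofReal (w v / (1 - τ)) • μ v) hS
  rw [measureReal_sum_ofReal_smul _ _ (fun v _ => div_nonneg (hw v) hτ0.le),
    measureReal_sum_ofReal_smul _ _ (fun v _ => div_nonneg (hw v) hτ'.le)] at hTV
  simp only [div_mul_eq_mul_div, ← Finset.sum_div] at hTV
  set P := ∑ v ∈ Finset.univ.filter (fun v : Fin k → Bool => v j = true), w v * (μ v).real S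
  set Q := ∑ v ∈ Finset.univ.filter (fun v : Fin k → Bool => v j = false), w v * (μ v).real S
    with hQ
  have hsplit : ∑ v, w v * (μ v).real {ω | T ω ≠ v j} = (τ - P) + Q := by
    rw [← Finset.sum_filter_add_sum_filter_not Finset.univ (fun v : Fin k → Bool => v j = true)]
    congr 1
    · rw [← hsum, ← Finset.sum_sub_distrib]
      refine Finset.sum_congr rfl fun v hv => ?_
      have hv' : v j = true := by simpa using hv
      have : {ω | T ω ≠ v j} = Sᶜ := by ext ω; simp [hSdef, hv']
      rw [this, probReal_compl_eq_one_sub hS]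
      ring
    · simp only [Bool.not_eq_true, hQ]
      refine Finset.sum_congr rfl fun v hv => ?_
      have hv' : v j = false := by simpa using hv
      have : {ω | T ω ≠ v j} = S := by ext ω; simp [hSdef, hv']
      rw [this]
  have hQ0 : 0 ≤ Q := Finset.sum_nonneg fun v _ => mul_nonneg (hw v) measureReal_nonneg
  rw [hsplit]
  have hQτ : τ * (Q / (1 - τ)) ≤ Q := by
    rw [← mul_div_assoc, div_le_iff₀ hτ']
    nlinarith
  have hPτ : τ * (P / τ) = P := by field_simp
  have := mul_le_mul_of_nonneg_left hTV hτ0.le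
  rw [mul_sub, hPτ] at this
  linarith

/-- The loss of an estimator dominates the expected Hamming loss of its nearest-point
projection. -/
theorem ofReal_mul_sum_le_lintegral {k : ℕ} {Θ Ω : Type*} [PseudoMetricSpace Θ]
    [MeasurableSpace Ω] (Φ : ℝ → ℝ) (hΦ : MonotoneOn Φ (Set.Ici 0)) {ϱ : ℝ} (hϱ : 0 ≤ ϱ)
    (θ : (Fin k → Bool) → Θ)
    (hsep : ∀ u v : Fin k → Bool,
      Φ (dist (θ u) (θ v) / 2)
        = 2 * ϱ * ((Finset.univ.filter fun j => u j ≠ v j).card : ℝ))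
    (θhat : Ω → Θ) (T : Ω → Fin k → Bool) (hT : Measurable T)
    (hnear : ∀ ω v, edist (θ (T ω)) (θhat ω) ≤ edist (θ v) (θhat ω))
    (μ : Measure Ω) [IsProbabilityMeasure μ] (v : Fin k → Bool) :
    ENNReal.ofReal (2 * ϱ * ∑ j, μ.real {ω | T ω j ≠ v j})
      ≤ ∫⁻ ω, ENNReal.ofReal (Φ (dist (θhat ω) (θ v))) ∂μ := by
  have hmeas : ∀ j, MeasurableSet {ω | T ω j ≠ v j} := fun j =>
    ((measurable_pi_iff.1 hT j) (measurableSet_singleton (v j))).compl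
  calc ENNReal.ofReal (2 * ϱ * ∑ j, μ.real {ω | T ω j ≠ v j})
      = ∫⁻ ω, ENNReal.ofReal (2 * ϱ) * ∑ j, Set.indicator {ω | T ω j ≠ v j} 1 ω ∂μ := by
        rw [lintegral_const_mul' _ _ ENNReal.ofReal_ne_top,
          lintegral_finsetSum _ fun j _ => measurable_one.indicator (hmeas j),
          ENNReal.ofReal_mul (by positivity),
          ENNReal.ofReal_sum_of_nonneg fun j _ => measureReal_nonneg]
        congr 1
        refine Finset.sum_congr rfl fun j _ => ?_
        rw [lintegral_indicator_one (hmeas j), ofReal_measureReal]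
    _ ≤ _ := by
        refine lintegral_mono fun ω => ?_
        have hle : dist (θ (T ω)) (θ v) / 2 ≤ dist (θhat ω) (θ v) := by
          have h₁ := hnear ω v
          rw [edist_dist, edist_dist, ENNReal.ofReal_le_ofReal_iff dist_nonneg] at h₁
          have h₂ := dist_triangle (θ (T ω)) (θhat ω) (θ v)
          rw [dist_comm (θ v)] at h₁
          linarith
        have hΦle := hΦ (Set.mem_Ici.2 (by positivity)) (Set.mem_Ici.2 dist_nonneg) hle
        rw [hsep] at hΦle
        refine le_trans (le_of_eq ?_) (ENNReal.ofReal_le_ofReal hΦle)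
        rw [ENNReal.ofReal_mul (p := 2 * ϱ) (by positivity), ENNReal.ofReal_natCast,
          Finset.card_filter]
        push_cast
        simp [Set.indicator_apply]

/-- Corollary C.4: a generalized Assouad lower bound for restricted subfamilies.
The hypercube `{−1,1}^k` is encoded as `Fin k → Bool`, with `true` standing for `+1`. -/
theorem assouad_generalized
    (k : ℕ) (hk : 1 ≤ k)
    {Θ : Type*} [MetricSpace Θ] [MeasurableSpace Θ] [BorelSpace Θ]
    (Φ : ℝ → ℝ) (hΦmono : MonotoneOn Φ (Set.Ici 0)) (hΦnonneg : ∀ x : ℝ, 0 ≤ x → 0 ≤ Φ x)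
    (ϱ : ℝ) (hϱ : 0 < ϱ)
    (θ : (Fin k → Bool) → Θ)
    (hsep : ∀ u v : Fin k → Bool,
      Φ (dist (θ u) (θ v) / 2)
        = 2 * ϱ * ((Finset.univ.filter fun j => u j ≠ v j).card : ℝ))
    {Ω : Type*} [MeasurableSpace Ω]
    (μ : (Fin k → Bool) → Measure Ω) (hμ : ∀ v, IsProbabilityMeasure (μ v))
    (τ : ℝ) (hτ0 : 0 < τ) (hτ1 : τ ≤ 1 / 2)
    (w : (Fin k → Bool) → ℝ)
    (hw : ∀ v : Fin k → Bool,
      w v = τ ^ (Finset.univ.filter fun j => v j = true).card *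
        (1 - τ) ^ (Finset.univ.filter fun j => v j = false).card)
    (Vstar : Finset (Fin k → Bool)) (c : ℝ) (hc : 0 < c)
    (hout : ∑ v ∈ Finset.univ \ Vstar, w v ≤ c * τ)
    (θhat : Ω → Θ) (hθhat : Measurable θhat) :
    ENNReal.ofReal (2 * ϱ * τ *
        ((∑ j : Fin k,
            (1 - tvDist
              (∑ v ∈ Finset.univ.filter (fun v => v j = true),
                ENNReal.ofReal (w v / τ) • μ v)
              (∑ v ∈ Finset.univ.filter (fun v => v j = false),
                ENNReal.ofReal (w v / (1 - τ)) • μ v))) - c * (k : ℝ)))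
      ≤ ⨆ v ∈ Vstar, ∫⁻ ω, ENNReal.ofReal (Φ (dist (θhat ω) (θ v))) ∂(μ v) := by
  have hτ' : 0 < 1 - τ := by linarith
  set p : Bool → ℝ := fun b => if b then τ else 1 - τ with hp
  have hp1 : p true + p false = 1 := by simp [hp]
  have hwp : ∀ v, w v = ∏ i, p (v i) := fun v => by
    rw [hw, pow_card_mul_pow_card_eq_prod]
  have hw0 : ∀ v, 0 ≤ w v := fun v => by rw [hw]; positivity
  have hw1 : ∑ v, w v = 1 := by simp only [hwp, sum_prod_eq_one p hp1]
  have hwτ : ∀ j, ∑ v ∈ Finset.univ.filter (fun v : Fin k → Bool => v j = true), w v = τ :=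
    fun j => by
      simp only [hwp, sum_filter_prod_eq p hp1]
      simp [hp]
  obtain ⟨proj, hproj⟩ := exists_simpleFunc_edist_le θ
  have hT : Measurable fun ω => proj (θhat ω) := proj.measurable.comp hθhat
  set r : (Fin k → Bool) → ℝ := fun v => ∑ j, (μ v).real {ω | proj (θhat ω) j ≠ v j} with hr
  have hrk : ∀ v, r v ≤ k := fun v => by
    calc r v ≤ ∑ _j : Fin k, (1 : ℝ) := Finset.sum_le_sum fun j _ => measureReal_le_one
      _ = k := by simp
  set D : Fin k → ℝ := fun j => tvDist
    (∑ v ∈ Finset.univ.filter (fun v => v j = true), ENNReal.ofReal (w v / τ) • μ v)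
    (∑ v ∈ Finset.univ.filter (fun v => v j = false), ENNReal.ofReal (w v / (1 - τ)) • μ v)
  have hall : τ * ∑ j, (1 - D j) ≤ ∑ v, w v * r v := by
    simp only [hr, Finset.mul_sum]
    rw [Finset.sum_comm]
    exact Finset.sum_le_sum fun j _ => mul_one_sub_tvDist_le μ hτ0 hτ1 w hw0 j (hwτ j)
      (fun ω => proj (θhat ω) j) (measurable_pi_iff.1 hT j)
  have hrest : ∑ v ∈ Finset.univ \ Vstar, w v * r v ≤ c * τ * k := by
    calc _ ≤ ∑ v ∈ Finset.univ \ Vstar, w v * k :=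
          Finset.sum_le_sum fun v _ => mul_le_mul_of_nonneg_left (hrk v) (hw0 v)
      _ = (∑ v ∈ Finset.univ \ Vstar, w v) * k := by rw [Finset.sum_mul]
      _ ≤ _ := by gcongr
  have hsplit := Finset.sum_sdiff (f := fun v => w v * r v) (Finset.subset_univ Vstar)
  set M := ⨆ v ∈ Vstar, ∫⁻ ω, ENNReal.ofReal (Φ (dist (θhat ω) (θ v))) ∂(μ v)
  by_cases hM : M = ⊤
  · rw [hM]; exact le_top
  rw [ENNReal.ofReal_le_iff_le_toReal hM]
  have hbound : ∀ v ∈ Vstar, 2 * ϱ * r v ≤ M.toReal := fun v hv => by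
    rw [← ENNReal.ofReal_le_iff_le_toReal hM]
    exact (ofReal_mul_sum_le_lintegral Φ hΦmono hϱ.le θ hsep θhat _ hT
      (fun ω u => hproj (θhat ω) u) (μ v) v).trans
      (le_iSup₂ (f := fun v (_ : v ∈ Vstar) =>
        ∫⁻ ω, ENNReal.ofReal (Φ (dist (θhat ω) (θ v))) ∂(μ v)) v hv)
  have havg : 2 * ϱ * ∑ v ∈ Vstar, w v * r v ≤ M.toReal := by
    calc 2 * ϱ * ∑ v ∈ Vstar, w v * r v = ∑ v ∈ Vstar, w v * (2 * ϱ * r v) := by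
          rw [Finset.mul_sum]; exact Finset.sum_congr rfl fun v _ => by ring
      _ ≤ ∑ v ∈ Vstar, w v * M.toReal :=
          Finset.sum_le_sum fun v hv => mul_le_mul_of_nonneg_left (hbound v hv) (hw0 v)
      _ ≤ ∑ v, w v * M.toReal := Finset.sum_le_sum_of_subset_of_nonneg (Finset.subset_univ _)
          fun v _ _ => mul_nonneg (hw0 v) ENNReal.toReal_nonneg
      _ = M.toReal := by rw [← Finset.sum_mul, hw1, one_mul]
  refine le_trans ?_ havg
  calc 2 * ϱ * τ * (∑ j, (1 - D j) - c * k)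
      = 2 * ϱ * (τ * ∑ j, (1 - D j) - c * τ * k) := by ring
    _ ≤ _ := mul_le_mul_of_nonneg_left (by linarith) (by positivity)
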